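/- The critical locus crit(g) = {z ∈ V : dg(z) = 0}, i.e. the set of points of V at which the (real) Fréchet derivative of g vanishes, is a compact subset of V (hence also of ℂ^m). -/

import Mathlib

open MvPolynomial
open scoped IntermediateField

/-- In a finitely generated field extension of characteristic zero, an element with vanishing
differential is algebraic over the base field. -/
theorem isAlgebraic_of_kaehlerDifferential_D_eq_zero {k K : Type*} [Field k] [CharZero k] [Field K]
    [Algebra k K] [Algebra.EssFiniteType k K] {x : K} (hx : KaehlerDifferential.D k K x = 0) :
    IsAlgebraic k x := by
  let F := IntermediateField.adjoin k {x}
  let y : F := ⟨x, IntermediateField.mem_adjoin_simple_self k x⟩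
  have : CharZero F := charZero_of_injective_algebraMap (algebraMap k F).injective
  have : Algebra.EssFiniteType F K := .of_comp k F K
  have : Subsingleton (Algebra.H1Cotangent F K) :=
    Algebra.FormallySmooth.subsingleton_h1Cotangent
  have hinj : Function.Injective (KaehlerDifferential.mapBaseChange k F K) := by
    rw [injective_iff_map_eq_zero]
    intro a ha
    obtain ⟨b, rfl⟩ := (Algebra.H1Cotangent.exact_δ_mapBaseChange k F K a).mp ha
    rw [Subsingleton.elim b 0, map_zero]
  have hy : KaehlerDifferential.D k F y = 0 := by
    apply Module.FaithfullyFlat.tensorProduct_mk_injective (A := F) (B := K)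
    apply hinj
    simpa [KaehlerDifferential.mapBaseChange_tmul] using hx
  have hD : ∀ z : F, KaehlerDifferential.D k F z = 0 := by
    rintro ⟨z, hz⟩
    induction hz using IntermediateField.adjoin_induction with
    | mem z hz => obtain rfl : z = x := hz; exact hy
    | algebraMap r => exact (KaehlerDifferential.D k F).map_algebraMap r
    | add a b ha hb iha ihb =>
      have := (KaehlerDifferential.D k F).map_add ⟨a, ha⟩ ⟨b, hb⟩
      rwa [iha, ihb, add_zero] at this
    | inv a ha iha =>
      have := (KaehlerDifferential.D k F).leibniz_inv ⟨a, ha⟩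
      rwa [iha, smul_zero] at this
    | mul a b ha hb iha ihb =>
      have := (KaehlerDifferential.D k F).leibniz ⟨a, ha⟩ ⟨b, hb⟩
      rwa [iha, ihb, smul_zero, smul_zero, add_zero] at this
  have : Subsingleton (Ω[F⁄k]) := by
    rw [← Submodule.subsingleton_iff F, ← subsingleton_iff_bot_eq_top,
      ← KaehlerDifferential.span_range_derivation, eq_comm, Submodule.span_eq_bot]
    rintro _ ⟨z, rfl⟩
    exact hD z
  have : Algebra.FormallyUnramified k F := ⟨this⟩
  have : Algebra.EssFiniteType k F :=
    IntermediateField.essFiniteType_iff.mpr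
      (IntermediateField.fg_adjoin_of_finite (Set.finite_singleton x))
  have : Algebra.IsSeparable k F := Algebra.FormallyUnramified.isSeparable k F
  exact (Algebra.IsAlgebraic.isAlgebraic (R := k) y).algebraMap (A := K)

/-- A function with vanishing differential on a variety takes finitely many values. -/
theorem finite_range_algHom_of_kaehlerDifferential_D_eq_zero {k A : Type*} [Field k] [CharZero k]
    [IsAlgClosed k] [CommRing A] [Algebra k A] [Algebra.FiniteType k A] {x : A}
    (hx : KaehlerDifferential.D k A x = 0) :
    (Set.range fun φ : A →ₐ[k] k ↦ φ x).Finite := by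
  have : IsNoetherianRing A := Algebra.FiniteType.isNoetherianRing k A
  have key : ∀ P ∈ minimalPrimes A, ∃ c : k, x - algebraMap k A c ∈ P := by
    intro P hP
    have : P.IsPrime := hP.1.1
    let K := FractionRing (A ⧸ P)
    have : Algebra.EssFiniteType k K := .comp k (A ⧸ P) K
    have hxK : KaehlerDifferential.D k K (algebraMap A K x) = 0 := by
      rw [← KaehlerDifferential.map_D k k, hx, map_zero]
    have hint := (isAlgebraic_of_kaehlerDifferential_D_eq_zero hxK).isIntegral
    have := IntermediateField.isAlgebraic_adjoin_simple hint
    have hmem := IntermediateField.mem_adjoin_simple_self k (algebraMap A K x)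
    rw [IntermediateField.eq_bot_of_isAlgClosed_of_isAlgebraic
      k⟮algebraMap A K x⟯,
      IntermediateField.mem_bot] at hmem
    obtain ⟨c, hc⟩ := hmem
    refine ⟨c, ?_⟩
    rw [← Ideal.Quotient.eq_zero_iff_mem, ← Ideal.Quotient.algebraMap_eq]
    apply IsFractionRing.injective (A ⧸ P) K
    rw [← IsScalarTower.algebraMap_apply, map_sub, ← hc, map_zero,
      ← IsScalarTower.algebraMap_apply k A K, sub_self]
  choose! c hc using key
  refine ((minimalPrimes.finite_of_isNoetherianRing A).image c).subset ?_
  rintro _ ⟨φ, rfl⟩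
  have : (RingHom.ker φ).IsPrime := RingHom.ker_isPrime φ
  obtain ⟨P, hP, hle⟩ := Ideal.exists_minimalPrimes_le (bot_le (a := RingHom.ker φ))
  refine ⟨P, hP, ?_⟩
  have := hle (hc P hP)
  rw [RingHom.mem_ker, map_sub, AlgHom.commutes, sub_eq_zero] at this
  exact this.symm

theorem Derivation.map_mvPolynomial_aeval {σ R A M : Type*} [Fintype σ] [CommRing R] [CommRing A]
    [Algebra R A] [AddCommGroup M] [Module A M] [Module R M] [IsScalarTower R A M]
    (D : Derivation R A M) (a : σ → A) (p : MvPolynomial σ R) :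
    D (aeval a p) = ∑ j, aeval a (pderiv j p) • D (a j) := by
  classical
  induction p using MvPolynomial.induction_on with
  | C r => simp [← algebraMap_eq]
  | add p q hp hq => simp [hp, hq, add_smul, Finset.sum_add_distrib]
  | mul_X p i hp =>
    simp [pderiv_X, hp, Derivation.leibniz, add_smul, Finset.sum_add_distrib, Finset.smul_sum,
      smul_smul, Pi.single_apply, apply_ite, ite_smul, mul_comm, add_comm]

theorem MvPolynomial.hasFDerivAt_eval {σ 𝕜 : Type*} [Fintype σ] [NontriviallyNormedField 𝕜]
    (p : MvPolynomial σ 𝕜) (z : σ → 𝕜) :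
    HasFDerivAt (fun z ↦ eval z p)
      (∑ j, eval z (pderiv j p) • ContinuousLinearMap.proj (R := 𝕜) (φ := fun _ ↦ 𝕜) j) z := by
  classical
  induction p using MvPolynomial.induction_on with
  | C r =>
    simp only [eval_C]
    exact (hasFDerivAt_const r z).congr_fderiv (by ext; simp)
  | add p q hp hq =>
    simp only [map_add]
    exact (hp.add hq).congr_fderiv (by ext; simp [add_mul, Finset.sum_add_distrib])
  | mul_X p i hp =>
    have := hp.mul (hasFDerivAt_apply (𝕜 := 𝕜) i z)
    simp only [map_mul, eval_X]
    refine this.congr_fderiv ?_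
    ext v
    simp [pderiv_X, add_mul, Finset.sum_add_distrib, Finset.mul_sum, Pi.single_apply, apply_ite,
      mul_assoc]

theorem conj_eq_of_fderiv_eq_zero {m : ℕ} (Δ : MvPolynomial (Fin m) ℂ)
    {z : Fin m → ℂ} (hz : eval z Δ ≠ 0) {g : (Fin m → ℂ) → ℝ}
    (hg : ∀ z, g z = (∑ j, ‖z j‖ ^ 2) + 1 / ‖eval z Δ‖ ^ 2) (h0 : fderiv ℝ g z = 0) (j : Fin m) :
    (starRingEnd ℂ) (z j) = ((‖eval z Δ‖ ^ 2)⁻¹ : ℝ) ^ 2 * (starRingEnd ℂ) (eval z Δ) *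
      eval z (pderiv j Δ) := by
  have h1 := ((MvPolynomial.hasFDerivAt_eval Δ z).restrictScalars ℝ).norm_sq
  have h2 := HasFDerivAt.fun_sum (u := Finset.univ) fun (i : Fin m) _ ↦
    ((hasFDerivAt_apply (𝕜 := ℝ) i z)).norm_sq
  have h3 := h2.add
    ((hasDerivAt_inv (pow_ne_zero 2 (norm_ne_zero_iff.mpr hz))).comp_hasFDerivAt z h1)
  have h4 : HasFDerivAt g _ z := h3.congr_of_eventuallyEq (.of_forall fun z ↦ by simp [hg])
  have h5 := h4.fderiv.symm.trans h0
  have h6 (w : ℂ) := DFunLike.congr_fun h5 (Pi.single j w)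
  simp [Pi.single_apply, apply_ite Complex.re, ← sub_eq_add_neg, mul_ite, ite_mul] at h6
  have h7 := h6 1
  have h8 := h6 Complex.I
  simp at h7 h8
  apply Complex.ext
  · rw [← Complex.ofReal_pow, mul_assoc, Complex.re_ofReal_mul]
    simp
    linarith
  · rw [← Complex.ofReal_pow, mul_assoc, Complex.im_ofReal_mul]
    simp
    linarith

theorem Derivation.map_sum_mul_add_eq_zero {ι k A M : Type*} [Fintype ι] [CommRing k] [CommRing A]
    [Algebra k A] [AddCommGroup M] [Module A M] [Module k M] [IsScalarTower k A M]
    (D : Derivation k A M) {p q : MvPolynomial ι k} {a b : ι → A} {t : A}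
    (ht : t * (aeval a p * aeval b q) = 1)
    (hb : ∀ j, b j = t ^ 2 * aeval b q * aeval a (pderiv j p))
    (ha : ∀ j, a j = t ^ 2 * aeval a p * aeval b (pderiv j q)) :
    D (∑ j, a j * b j + t) = 0 := by
  have hDt : D t = - ∑ j, (b j • D (a j) + a j • D (b j)) := by
    have h := congr_arg (t • D ·) ht
    simp only [Derivation.leibniz, Derivation.map_one_eq_zero, smul_zero, smul_add, smul_smul] at h
    rw [ht, one_smul] at h
    rw [← sub_eq_zero, sub_neg_eq_add, ← h, add_comm (D t)]
    rw [Derivation.map_mvPolynomial_aeval D a p, Derivation.map_mvPolynomial_aeval D b q]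
    rw [Finset.sum_add_distrib, Finset.smul_sum, Finset.smul_sum, add_left_inj, add_comm]
    congr 1 <;> refine Finset.sum_congr rfl fun j _ ↦ ?_
    · rw [smul_smul]; conv_lhs => rw [ha j]
      congr 1; ring
    · rw [smul_smul]; conv_lhs => rw [hb j]
      congr 1; ring
  rw [map_add, hDt, map_sum]
  simp [add_comm]

/-- The function `∑ j, a j * b j + 1 / (p(a) * q(b))` takes finitely many values on its critical
locus, here described by the equations `hb` and `ha` with `t = 1 / (p(a) * q(b))`. -/
theorem finite_image_sum_mul_add {ι k X : Type*} [Fintype ι] [Field k] [CharZero k] [IsAlgClosed k]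
    {p q : MvPolynomial ι k} (a b : ι → X → k) (t : X → k) {S : Set X}
    (ht : ∀ x ∈ S, t x * (eval (a · x) p * eval (b · x) q) = 1)
    (hb : ∀ x ∈ S, ∀ j, b j x = t x ^ 2 * eval (b · x) q * eval (a · x) (pderiv j p))
    (ha : ∀ x ∈ S, ∀ j, a j x = t x ^ 2 * eval (a · x) p * eval (b · x) (pderiv j q)) :
    ((fun x ↦ ∑ j, a j x * b j x + t x) '' S).Finite := by
  let res : (X → k) → S → k := fun f x ↦ f x
  let G : Set (S → k) := Set.range (res ∘ a) ∪ Set.range (res ∘ b) ∪ {res t}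
  let A : Subalgebra k (S → k) := Algebra.adjoin k G
  have hG : G.Finite :=
    ((Set.finite_range _).union (Set.finite_range _)).union (Set.finite_singleton _)
  have : Algebra.FiniteType k A :=
    A.fg_iff_finiteType.mp (Subalgebra.fg_def.mpr ⟨G, hG, rfl⟩)
  let a' (j : ι) : A := ⟨res (a j), Algebra.subset_adjoin (.inl (.inl ⟨j, rfl⟩))⟩
  let b' (j : ι) : A := ⟨res (b j), Algebra.subset_adjoin (.inl (.inr ⟨j, rfl⟩))⟩
  let t' : A := ⟨res t, Algebra.subset_adjoin (.inr rfl)⟩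
  let ev (x : S) : A →ₐ[k] k := (Pi.evalAlgHom k (fun _ ↦ k) x).comp A.val
  have hext {f g : A} (h : ∀ x, ev x f = ev x g) : f = g := Subtype.ext (funext h)
  have haev (x : S) (c : ι → A) (r : MvPolynomial ι k) :
      ev x (aeval c r) = eval (fun j ↦ ev x (c j)) r := by
    rw [← AlgHom.comp_apply, comp_aeval, ← coe_aeval_eq_eval]; rfl
  have hD : KaehlerDifferential.D k A (∑ j, a' j * b' j + t') = 0 := by
    apply Derivation.map_sum_mul_add_eq_zero (p := p) (q := q)
    · refine hext fun x ↦ ?_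
      simp only [map_mul, haev, map_one]
      exact ht x x.2
    · refine fun j ↦ hext fun x ↦ ?_
      simp only [map_mul, map_pow, haev]
      exact hb x x.2 j
    · refine fun j ↦ hext fun x ↦ ?_
      simp only [map_mul, map_pow, haev]
      exact ha x x.2 j
  refine (finite_range_algHom_of_kaehlerDifferential_D_eq_zero hD).subset ?_
  rintro _ ⟨x, hx, rfl⟩
  refine ⟨ev ⟨x, hx⟩, ?_⟩
  simp only [map_add, map_sum, map_mul]
  rfl

/-- The critical locus of `g(z) = |z_1|² + … + |z_m|² + 1/|Δ(z)|²` on the discriminantal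
variety `V`, i.e. the set of points of `V` where the real Fréchet derivative of `g` vanishes,
is compact. -/
theorem crit_g_compact
    (m : ℕ) (hm : 1 ≤ m) (Δ : MvPolynomial (Fin m) ℂ) (hΔ : Δ ≠ 0)
    (g : (Fin m → ℂ) → ℝ)
    (hg : ∀ z, g z = (∑ j, ‖z j‖ ^ 2) + 1 / ‖MvPolynomial.eval z Δ‖ ^ 2) :
    IsCompact {z : Fin m → ℂ | MvPolynomial.eval z Δ ≠ 0 ∧ fderiv ℝ g z = 0} := by
  set S := {z : Fin m → ℂ | MvPolynomial.eval z Δ ≠ 0 ∧ fderiv ℝ g z = 0} with hS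
  have hconj (p : MvPolynomial (Fin m) ℂ) (z : Fin m → ℂ) :
      eval (fun j ↦ (starRingEnd ℂ) (z j)) (map (starRingEnd ℂ) p) = (starRingEnd ℂ) (eval z p) := by
    rw [eval_map]
    exact (eval₂_comp (starRingEnd ℂ) z p).symm
  have hfin : (g '' S).Finite := by
    have h := finite_image_sum_mul_add (p := Δ) (q := map (starRingEnd ℂ) Δ) (S := S)
      (fun j z ↦ z j) (fun j z ↦ (starRingEnd ℂ) (z j))
      (fun z ↦ (((‖eval z Δ‖ ^ 2)⁻¹ : ℝ) : ℂ)) ?_ ?_ ?_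
    · refine (h.image Complex.re).subset ?_
      rintro _ ⟨z, hz, rfl⟩
      refine ⟨_, ⟨z, hz, rfl⟩, ?_⟩
      simp only [Complex.mul_conj, hg, Complex.normSq_eq_norm_sq]
      norm_cast
      simp
    · intro z hz
      rw [hconj, Complex.mul_conj, Complex.normSq_eq_norm_sq, ← Complex.ofReal_mul,
        inv_mul_cancel₀ (pow_ne_zero 2 (norm_ne_zero_iff.mpr hz.1)), Complex.ofReal_one]
    · intro z hz j
      rw [hconj]
      exact conj_eq_of_fderiv_eq_zero Δ hz.1 hg hz.2 j
    · intro z hz j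
      have := congr_arg (starRingEnd ℂ) (conj_eq_of_fderiv_eq_zero Δ hz.1 hg hz.2 j)
      simpa only [map_mul, map_pow, Complex.conj_ofReal, Complex.conj_conj, pderiv_map,
        hconj] using this
  obtain ⟨C, hC⟩ := hfin.bddAbove
  have hCS (z) (hz : z ∈ S) : g z ≤ C := hC ⟨z, hz, rfl⟩
  have hcont : Continuous fun z ↦ eval z Δ := MvPolynomial.continuous_eval Δ
  let K : Set (Fin m → ℂ) := {z | ∑ j, ‖z j‖ ^ 2 ≤ C ∧ 1 ≤ C * ‖eval z Δ‖ ^ 2}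
  have hKV : ∀ z ∈ K, eval z Δ ≠ 0 := by
    intro z hz h
    have := hz.2
    simp [h] at this
    linarith
  have hKclosed : IsClosed K := by
    have h1 : IsClosed {z : Fin m → ℂ | ∑ j, ‖z j‖ ^ 2 ≤ C} :=
      isClosed_le (by fun_prop) continuous_const
    have h2 : IsClosed {z : Fin m → ℂ | 1 ≤ C * ‖eval z Δ‖ ^ 2} :=
      isClosed_le continuous_const (by fun_prop)
    exact h1.inter h2
  have hKcomp : IsCompact K := by
    refine Metric.isCompact_of_isClosed_isBounded hKclosed ?_
    refine (Metric.isBounded_closedBall (x := 0) (r := √C)).subset fun z hz ↦ ?_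
    rw [mem_closedBall_zero_iff, pi_norm_le_iff_of_nonneg (Real.sqrt_nonneg _)]
    intro j
    apply Real.le_sqrt_of_sq_le
    exact (Finset.single_le_sum (f := fun j ↦ ‖z j‖ ^ 2) (fun _ _ ↦ by positivity)
      (Finset.mem_univ j)).trans hz.1
  have hdiff : ContDiffOn ℝ 1 g {z | eval z Δ ≠ 0} := by
    intro z hz
    have hp : ContDiffAt ℝ 1 (fun z ↦ eval z Δ) z :=
      ((AnalyticOnNhd.eval_mvPolynomial Δ z trivial).contDiffAt).restrict_scalars ℝ
    have : ContDiffAt ℝ 1 (fun z : Fin m → ℂ ↦ (∑ j, ‖z j‖ ^ 2) + 1 / ‖eval z Δ‖ ^ 2) z := by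
      refine .add (.sum fun j _ ↦ (contDiffAt_apply ..).norm_sq ℝ) ?_
      exact .div contDiffAt_const (hp.norm_sq ℝ) (pow_ne_zero 2 (norm_ne_zero_iff.mpr hz))
    rw [funext hg]
    exact this.contDiffWithinAt
  have hfc : ContinuousOn (fderiv ℝ g) K :=
    (hdiff.continuousOn_fderiv_of_isOpen (isOpen_ne_fun hcont continuous_const) le_rfl).mono hKV
  have hSK : S = K ∩ fderiv ℝ g ⁻¹' {0} := by
    ext z
    refine ⟨fun hz ↦ ⟨?_, hz.2⟩, fun hz ↦ ⟨hKV z hz.1, hz.2⟩⟩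
    have h := hCS z hz
    have hpos : 0 < ‖eval z Δ‖ ^ 2 := pow_pos (norm_pos_iff.mpr hz.1) 2
    have h1 : 0 ≤ ∑ j, ‖z j‖ ^ 2 := Finset.sum_nonneg fun _ _ ↦ by positivity
    have h2 : 0 < 1 / ‖eval z Δ‖ ^ 2 := by positivity
    rw [hg] at h
    exact ⟨by linarith, (div_le_iff₀ hpos).mp (by linarith)⟩
  rw [hSK]
  exact hKcomp.of_isClosed_subset (hfc.preimage_isClosed_of_isClosed hKclosed isClosed_singleton)
    Set.inter_subset_left
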